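/- arXiv:2104.10160 — 2 statements merged into one kernel-verified Lean document; each statement's English description precedes it below -/
import Mathlib

section
/- Assume R is right semihereditary and M is an s-torsion left R-module. If M has the low-pp descending chain condition, then M is K^{s-Tor}-pure-injective. -/
/- Core notions: pp-formulas, low formulas, s-torsion modules, pure embeddings. -/

universe u

open Cardinal

/-- A positive primitive (pp) formula in `n` free variables over the ring `R`:
an existentially quantified finite system of linear equations.  It is given by the
number of existentially quantified variables, the number of equations, and the
matrices of coefficients of the free and of the existentially quantified variables. -/
structure PPFormula (R : Type u) [Ring R] (n : ℕ) : Type u where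
  nExist : ℕ
  nEq : ℕ
  coeffFree : Fin nEq → Fin n → R
  coeffExist : Fin nEq → Fin nExist → R

/-- Satisfaction of a pp-formula by a tuple in a module. -/
def PPFormula.Sat {R : Type u} [Ring R] {n : ℕ} (φ : PPFormula R n)
    (M : Type u) [AddCommGroup M] [Module R M] (x : Fin n → M) : Prop :=
  ∃ y : Fin φ.nExist → M,
    ∀ i : Fin φ.nEq,
      (∑ j, φ.coeffFree i j • x j) + (∑ j, φ.coeffExist i j • y j) = 0

/-- The solution set of a pp-formula in one free variable in a module. -/
def PPFormula.solSet {R : Type u} [Ring R] (φ : PPFormula R 1)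
    (M : Type u) [AddCommGroup M] [Module R M] : Set M :=
  {m | φ.Sat M fun _ => m}

/-- A pp-formula `ψ(x)` in one free variable is low if `ψ[R] = 0`, i.e. `0` is the only
element of the left regular module `R` satisfying it. -/
def PPFormula.IsLow {R : Type u} [Ring R] (φ : PPFormula R 1) : Prop :=
  ∀ r : R, φ.Sat R (fun _ => r) → r = 0

/-- `sSet R M` is the set of elements of `M` satisfying some low pp-formula;
this is Martsinkovsky-Russell's radical `𝔰(M)`. -/
def sSet (R : Type u) [Ring R] (M : Type u) [AddCommGroup M] [Module R M] : Set M :=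
  {m | ∃ φ : PPFormula R 1, φ.IsLow ∧ φ.Sat M fun _ => m}

/-- A module is `𝔰`-torsion if every element satisfies some low pp-formula. -/
def IsSTorsion (R : Type u) [Ring R] (M : Type u) [AddCommGroup M] [Module R M] : Prop :=
  ∀ m : M, m ∈ sSet R M

/-- A linear map is a pure embedding if it is injective and pp-formulas are
reflected: any tuple whose image satisfies a pp-formula already satisfies it. -/
def IsPureEmb {R : Type u} [Ring R] {M N : Type u} [AddCommGroup M] [Module R M]
    [AddCommGroup N] [Module R N] (f : M →ₗ[R] N) : Prop :=
  Function.Injective f ∧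
    ∀ (k : ℕ) (φ : PPFormula R k) (x : Fin k → M), φ.Sat N (⇑f ∘ x) → φ.Sat M x

/-- `M` is a `K^{𝔰-Tor}`-pure-injective module: it is `𝔰`-torsion and any homomorphism
from an `𝔰`-torsion module to `M` extends along any pure embedding between `𝔰`-torsion
modules. -/
def IsKsTorPureInjective (R : Type u) [Ring R] (M : Type u)
    [AddCommGroup M] [Module R M] : Prop :=
  IsSTorsion R M ∧
    ∀ (N₁ N₂ : Type u) [AddCommGroup N₁] [Module R N₁] [AddCommGroup N₂] [Module R N₂],
      IsSTorsion R N₁ → IsSTorsion R N₂ →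
        ∀ (g : N₁ →ₗ[R] N₂), IsPureEmb g →
          ∀ f : N₁ →ₗ[R] M, ∃ h : N₂ →ₗ[R] M, h.comp g = f

/-- `M` is `Σ`-`K^{𝔰-Tor}`-pure-injective: every direct sum of copies of `M` is
`K^{𝔰-Tor}`-pure-injective. -/
def IsSigmaKsTorPureInjective (R : Type u) [Ring R] (M : Type u)
    [AddCommGroup M] [Module R M] : Prop :=
  ∀ I : Type u, IsKsTorPureInjective R (DirectSum I fun _ => M)

/-- `M` has the low-pp descending chain condition. -/
def LowPPDCC (R : Type u) [Ring R] (M : Type u) [AddCommGroup M] [Module R M] : Prop :=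
  ∀ φ : ℕ → PPFormula R 1, (φ 0).IsLow →
    (∀ n : ℕ, (φ (n + 1)).solSet M ⊆ (φ n).solSet M) →
      ∃ n₀ : ℕ, ∀ k : ℕ, n₀ ≤ k → (φ n₀).solSet M = (φ k).solSet M

/-- The class of `𝔰`-torsion left `R`-modules is nontrivial. -/
def KsTorNontrivial (R : Type u) [Ring R] : Prop :=
  ∃ (M : Type u) (_ : AddCommGroup M) (_ : Module R M), IsSTorsion R M ∧ Nontrivial M

/-- `R` is right semihereditary: every finitely generated submodule of a projective
right `R`-module (i.e. left `Rᵐᵒᵖ`-module) is projective. -/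
def RightSemihereditary (R : Type u) [Ring R] : Prop :=
  ∀ (P : Type u) [AddCommGroup P] [Module Rᵐᵒᵖ P], Module.Projective Rᵐᵒᵖ P →
    ∀ N : Submodule Rᵐᵒᵖ P, N.FG → Module.Projective Rᵐᵒᵖ ↥N

/-- Equality of the pp-types of `b₁` over `M` in `N₁` and of `b₂` over `M` in `N₂`,
where `M` is embedded in `N₁`, `N₂` via `i₁`, `i₂`. -/
def PPTypeEq (R : Type u) [Ring R] (n : ℕ) (M N₁ N₂ : Type u)
    [AddCommGroup M] [Module R M] [AddCommGroup N₁] [Module R N₁]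
    [AddCommGroup N₂] [Module R N₂]
    (i₁ : M →ₗ[R] N₁) (i₂ : M →ₗ[R] N₂) (b₁ : Fin n → N₁) (b₂ : Fin n → N₂) : Prop :=
  ∀ (l : ℕ) (φ : PPFormula R (n + l)) (a : Fin l → M),
    φ.Sat N₁ (Fin.append b₁ (⇑i₁ ∘ a)) ↔ φ.Sat N₂ (Fin.append b₂ (⇑i₂ ∘ a))

section helpers

variable {R : Type u} [Ring R] {M P : Type u} [AddCommGroup M] [Module R M]
  [AddCommGroup P] [Module R P]

/-- Finite linear systems with constants in `M` solvable in `P` modulo `K` are solvable in `M`. -/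
def Refl (i : M →ₗ[R] P) (K : Submodule R P) : Prop :=
  ∀ (p q : ℕ) (B : Fin p → Fin q → R) (m : Fin p → M) (y : Fin q → P),
    (∀ a, i (m a) + ∑ j, B a j • y j ∈ K) → ∃ z : Fin q → M, ∀ a, m a + ∑ j, B a j • z j = 0

/-- `b` solves `φ` with constants `m`, modulo `K`. -/
def Real' (i : M →ₗ[R] P) (K : Submodule R P) (b : P) (φ : PPFormula R 1)
    (m : Fin φ.nEq → M) : Prop :=
  ∃ y : Fin φ.nExist → P, ∀ a, i (m a) + φ.coeffFree a 0 • b + ∑ j, φ.coeffExist a j • y j ∈ K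

/-- `c` solves `φ` with constants `m` in `M`. -/
def RealM (c : M) (φ : PPFormula R 1) (m : Fin φ.nEq → M) : Prop :=
  ∃ y : Fin φ.nExist → M, ∀ a, m a + φ.coeffFree a 0 • c + ∑ j, φ.coeffExist a j • y j = 0

/-- Conjunction. -/
def conj (φ ψ : PPFormula R 1) : PPFormula R 1 where
  nExist := φ.nExist + ψ.nExist
  nEq := φ.nEq + ψ.nEq
  coeffFree := Fin.append φ.coeffFree ψ.coeffFree
  coeffExist := Fin.append (fun a => Fin.append (φ.coeffExist a) 0)
    (fun a => Fin.append 0 (ψ.coeffExist a))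

theorem sum_conj_left (φ ψ : PPFormula R 1) (a : Fin φ.nEq)
    (y : Fin (φ.nExist + ψ.nExist) → P) :
    ∑ j : Fin (conj φ ψ).nExist, (conj φ ψ).coeffExist (Fin.castAdd ψ.nEq a) j • y j =
      ∑ j, φ.coeffExist a j • y (Fin.castAdd _ j) := by
  refine (Fin.sum_univ_add (a := φ.nExist) (b := ψ.nExist) _).trans ?_
  simp [conj]

theorem sum_conj_right (φ ψ : PPFormula R 1) (a : Fin ψ.nEq)
    (y : Fin (φ.nExist + ψ.nExist) → P) :
    ∑ j : Fin (conj φ ψ).nExist, (conj φ ψ).coeffExist (Fin.natAdd φ.nEq a) j • y j =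
      ∑ j, ψ.coeffExist a j • y (Fin.natAdd _ j) := by
  refine (Fin.sum_univ_add (a := φ.nExist) (b := ψ.nExist) _).trans ?_
  simp [conj]

theorem free_conj_left (φ ψ : PPFormula R 1) (a : Fin φ.nEq) :
    (conj φ ψ).coeffFree (Fin.castAdd ψ.nEq a) 0 = φ.coeffFree a 0 := by simp [conj]

theorem free_conj_right (φ ψ : PPFormula R 1) (a : Fin ψ.nEq) :
    (conj φ ψ).coeffFree (Fin.natAdd φ.nEq a) 0 = ψ.coeffFree a 0 := by simp [conj]

theorem mem_solSet (φ : PPFormula R 1) (c : M) : c ∈ φ.solSet M ↔ RealM c φ 0 := by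
  simp [PPFormula.solSet, PPFormula.Sat, RealM]

theorem realM_conj (c : M) (φ ψ : PPFormula R 1) (m : Fin φ.nEq → M) (n : Fin ψ.nEq → M) :
    RealM c (conj φ ψ) (Fin.append m n) ↔ RealM c φ m ∧ RealM c ψ n := by
  constructor
  · rintro ⟨y, hy⟩
    refine ⟨⟨fun j => y (Fin.castAdd _ j), fun a => ?_⟩, ⟨fun j => y (Fin.natAdd _ j), fun a => ?_⟩⟩
    · have := hy (Fin.castAdd _ a)
      rwa [sum_conj_left φ ψ a y, free_conj_left, Fin.append_left] at this
    · have := hy (Fin.natAdd _ a)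
      rwa [sum_conj_right φ ψ a y, free_conj_right, Fin.append_right] at this
  · rintro ⟨⟨y, hy⟩, ⟨z, hz⟩⟩
    refine ⟨Fin.append y z, fun a => ?_⟩
    refine Fin.addCases (fun a => ?_) (fun a => ?_) a
    · rw [sum_conj_left, free_conj_left, Fin.append_left]
      simpa using hy a
    · rw [sum_conj_right, free_conj_right, Fin.append_right]
      simpa using hz a

theorem real_conj (i : M →ₗ[R] P) (K : Submodule R P) (b : P) (φ ψ : PPFormula R 1)
    (m : Fin φ.nEq → M) (n : Fin ψ.nEq → M) (h1 : Real' i K b φ m) (h2 : Real' i K b ψ n) :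
    Real' i K b (conj φ ψ) (Fin.append m n) := by
  obtain ⟨y, hy⟩ := h1
  obtain ⟨z, hz⟩ := h2
  refine ⟨Fin.append y z, fun a => ?_⟩
  refine Fin.addCases (fun a => ?_) (fun a => ?_) a
  · rw [sum_conj_left, free_conj_left, Fin.append_left]
    simpa using hy a
  · rw [sum_conj_right, free_conj_right, Fin.append_right]
    simpa using hz a

theorem RealM.add {c d : M} {φ : PPFormula R 1} {m n : Fin φ.nEq → M}
    (h1 : RealM c φ m) (h2 : RealM d φ n) : RealM (c + d) φ (m + n) := by
  obtain ⟨y, hy⟩ := h1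
  obtain ⟨z, hz⟩ := h2
  refine ⟨y + z, fun a => ?_⟩
  have := congrArg₂ (· + ·) (hy a) (hz a)
  simp only [add_zero] at this
  rw [← this]
  simp only [Pi.add_apply, smul_add, Finset.sum_add_distrib]
  abel

theorem RealM.neg {c : M} {φ : PPFormula R 1} {m : Fin φ.nEq → M}
    (h1 : RealM c φ m) : RealM (-c) φ (-m) := by
  obtain ⟨y, hy⟩ := h1
  refine ⟨-y, fun a => ?_⟩
  have := congrArg (- ·) (hy a)
  simp only [neg_zero] at this
  rw [← this]
  simp only [Pi.neg_apply, smul_neg, Finset.sum_neg_distrib]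
  abel

theorem exists_real {i : M →ₗ[R] P} {K : Submodule R P} (hK : Refl i K) {b : P}
    {φ : PPFormula R 1} {m : Fin φ.nEq → M} (h : Real' i K b φ m) : ∃ c, RealM c φ m := by
  obtain ⟨y, hy⟩ := h
  obtain ⟨z, hz⟩ := hK _ _ (fun a => Fin.cons (φ.coeffFree a 0) (φ.coeffExist a)) m
    (Fin.cons b y) (fun a => by
      have := hy a
      simpa [Fin.sum_univ_succ, add_assoc] using this)
  refine ⟨z 0, fun j => z j.succ, fun a => ?_⟩
  have := hz a
  simpa [Fin.sum_univ_succ, add_assoc] using this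

theorem exists_min (hdcc : LowPPDCC R M) (i : M →ₗ[R] P) (K : Submodule R P) (b : P)
    (φ : PPFormula R 1) (hφ : φ.IsLow) (hb : Real' i K b φ 0) :
    ∃ (ψ : PPFormula R 1) (m : Fin ψ.nEq → M), Real' i K b ψ m ∧
      ∀ (χ : PPFormula R 1) (n : Fin χ.nEq → M), Real' i K b χ n →
        ¬ (χ.solSet M ⊂ ψ.solSet M) := by
  by_contra! H
  let T := {D : Σ ψ : PPFormula R 1, (Fin ψ.nEq → M) // Real' i K b D.1 D.2}
  have step : ∀ D : T, ∃ E : T, E.1.1.solSet M ⊂ D.1.1.solSet M := by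
    rintro ⟨⟨ψ, m⟩, h⟩
    obtain ⟨χ, n, h1, h2⟩ := H ψ m h
    exact ⟨⟨⟨χ, n⟩, h1⟩, h2⟩
  choose s hs using step
  let D : ℕ → T := fun n => s^[n] ⟨⟨φ, 0⟩, hb⟩
  have hD : ∀ n, D (n + 1) = s (D n) := fun n => Function.iterate_succ_apply' _ _ _
  obtain ⟨n, hn⟩ := hdcc (fun n => (D n).1.1) hφ (fun n => by
    simp only [hD]; exact (hs _).subset)
  have h1 := hn (n + 1) (by omega)
  have h2 := hs (D n)
  rw [← hD, ← h1] at h2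
  exact (ssubset_irrefl _ h2)

theorem exists_c (hdcc : LowPPDCC R M) {i : M →ₗ[R] P} {K : Submodule R P} (hK : Refl i K) (b : P)
    (φ : PPFormula R 1) (hφ : φ.IsLow) (hb : Real' i K b φ 0) :
    ∃ c : M, ∀ (χ : PPFormula R 1) (n : Fin χ.nEq → M), Real' i K b χ n → RealM c χ n := by
  obtain ⟨ψ, m, h1, h2⟩ := exists_min hdcc i K b φ hφ hb
  obtain ⟨c, hc⟩ := exists_real hK h1
  refine ⟨c, fun χ n hn => ?_⟩
  have h3 := real_conj i K b ψ χ m n h1 hn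
  obtain ⟨d, hd⟩ := exists_real hK h3
  rw [realM_conj] at hd
  have h4 := h2 _ _ h3
  have h00 : (Fin.append 0 0 : Fin (ψ.nEq + χ.nEq) → M) = 0 := by
    funext a
    refine Fin.addCases (fun a => ?_) (fun a => ?_) a <;> simp
  have key : ∀ x : M, x ∈ (conj ψ χ).solSet M ↔ RealM x ψ 0 ∧ RealM x χ 0 := by
    intro x
    rw [mem_solSet, ← realM_conj, h00]
    rfl
  have h5 : (conj ψ χ).solSet M = ψ.solSet M := by
    by_contra hne
    refine h4 (LE.le.ssubset_of_ne (fun x hx => ?_) hne)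
    rw [mem_solSet]
    exact ((key x).1 hx).1
  have h6 : c + -d ∈ ψ.solSet M := by
    rw [mem_solSet]
    simpa using hc.add hd.1.neg
  rw [← h5, key] at h6
  simpa using h6.2.add hd.2

theorem refl_sup {i : M →ₗ[R] P} {K : Submodule R P} (b : P) (c : M)
    (hc : ∀ (χ : PPFormula R 1) (n : Fin χ.nEq → M), Real' i K b χ n → RealM c χ n) :
    Refl i (K ⊔ R ∙ (b - i c)) := by
  intro p q B m y h
  have h' : ∀ a, ∃ r : R, i (m a) + ∑ j, B a j • y j - r • (b - i c) ∈ K := by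
    intro a
    obtain ⟨k, hk, w, hw, e⟩ := Submodule.mem_sup.1 (h a)
    obtain ⟨r, rfl⟩ := Submodule.mem_span_singleton.1 hw
    exact ⟨r, by rw [← e]; simpa using hk⟩
  choose r hr using h'
  obtain ⟨z, hz⟩ := hc ⟨q, p, fun a _ => - r a, B⟩ (fun a => m a + r a • c) ⟨y, fun a => by
    convert hr a using 1
    simp only [map_add, map_smul, smul_sub, neg_smul]
    abel⟩
  exact ⟨z, fun a => by simpa using hz a⟩

theorem exists_max {i : M →ₗ[R] P} {K : Submodule R P} (hK : Refl i K) :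
    ∃ L, K ≤ L ∧ Maximal (Refl i) L := by
  refine zorn_le_nonempty₀ {L | Refl i L} (fun C hC hch L hL => ⟨sSup C, ?_, fun _ h => le_sSup h⟩)
    K hK
  intro p q B m y h
  have hd : DirectedOn (· ≤ ·) C := hch.directedOn
  have h' : ∀ a, ∃ L : C, i (m a) + ∑ j, B a j • y j ∈ L.1 := by
    intro a
    obtain ⟨L, hL, h⟩ := (Submodule.mem_sSup_of_directed ⟨L, hL⟩ hd).1 (h a)
    exact ⟨⟨L, hL⟩, h⟩
  choose F hF using h'
  have : Nonempty C := ⟨⟨L, hL⟩⟩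
  have hd' : Directed (· ≤ ·) (fun x : C => x.1) := hd.directed_val
  obtain ⟨N, hN⟩ := hd'.finite_le F
  exact hC N.2 p q B m y (fun a => hN a (hF a))

end helpers

/-- **Lemma.** Assume `R` is right semihereditary and `M` is an `𝔰`-torsion module.
If `M` has the low-pp descending chain condition, then `M` is
`K^{𝔰-Tor}`-pure-injective. -/
theorem ksTorPureInjective_of_lowPPDCC (R : Type u) [Ring R]
    (hsh : RightSemihereditary R)
    (M : Type u) [AddCommGroup M] [Module R M] (hM : IsSTorsion R M)
    (hdcc : LowPPDCC R M) : IsKsTorPureInjective R M := by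
  refine ⟨hM, ?_⟩
  intro N₁ N₂ _ _ _ _ _ hN₂ g hg f
  let i : M →ₗ[R] M × N₂ := LinearMap.inl R M N₂
  let K₀ : Submodule R (M × N₂) := LinearMap.range (f.prod (-g))
  have hK₀ : Refl i K₀ := by
    intro p q B m y h
    choose n hn using h
    obtain ⟨w, hw⟩ := hg.2 p ⟨q, p, fun a b => if a = b then 1 else 0, B⟩ n
      ⟨fun j => (y j).2, fun a => by
        have := congrArg Prod.snd (hn a)
        simp [i, Prod.snd_sum] at this
        simp [← this]⟩
    refine ⟨fun j => (y j).1 + f (w j), fun a => ?_⟩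
    have h1 := congrArg Prod.fst (hn a)
    have h2 := congrArg f (hw a)
    simp [i, Prod.fst_sum] at h1 h2
    simp only [smul_add, Finset.sum_add_distrib, ← add_assoc, ← h1, h2]
  obtain ⟨K, hle, hK⟩ := exists_max hK₀
  have hsurj : ∀ b : N₂, ∃ c : M, LinearMap.inr R M N₂ b - i c ∈ K := by
    intro b
    obtain ⟨φ, hφ, y, hy⟩ := hN₂ b
    obtain ⟨c, hc⟩ := exists_c hdcc hK.1 (LinearMap.inr R M N₂ b) φ hφ
      ⟨fun j => LinearMap.inr R M N₂ (y j), fun a => by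
        have := congrArg (LinearMap.inr R M N₂) (hy a)
        simp only [map_add, map_sum, map_smul, map_zero, Fin.sum_univ_one] at this
        simp only [Pi.zero_apply, map_zero, zero_add, this, K.zero_mem]⟩
    refine ⟨c, ?_⟩
    have := hK.2 (refl_sup _ c hc) le_sup_left
    exact this (Submodule.mem_sup_right (Submodule.mem_span_singleton_self _))
  let e : M →ₗ[R] (M × N₂) ⧸ K := K.mkQ.comp i
  have he : Function.Bijective e := by
    constructor
    · rw [injective_iff_map_eq_zero]
      intro m hm
      have hm' : i m ∈ K := by simpa [e] using hm
      obtain ⟨z, hz⟩ := hK.1 1 0 (fun _ j => j.elim0) (fun _ => m) (fun j => j.elim0)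
        (fun a => by simpa using hm')
      simpa using hz 0
    · intro x
      obtain ⟨⟨m, n⟩, rfl⟩ := K.mkQ_surjective x
      obtain ⟨c, hc⟩ := hsurj n
      refine ⟨m + c, ?_⟩
      have h3 : (m, n) - i (m + c) ∈ K := by
        convert hc using 1
        simp [i]
      symm
      exact (Submodule.Quotient.eq K).2 h3
  let E := LinearEquiv.ofBijective e he
  refine ⟨E.symm.toLinearMap.comp (K.mkQ.comp (LinearMap.inr R M N₂)), ?_⟩
  ext n
  simp only [LinearMap.comp_apply, LinearEquiv.coe_coe]
  rw [LinearEquiv.symm_apply_eq]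
  symm
  refine (Submodule.Quotient.eq K).2 (hle ⟨n, ?_⟩)
  simp [i]
end

section
/- Assume R is right semihereditary. Then for every left R-module M: (1) s(s(M)) = s(M), i.e., the radical s is idempotent; (2) s(M) is an s-torsion module. -/
/- Core notions: pp-formulas, low formulas, s-torsion modules, pure embeddings. -/

universe u

open Cardinal

/-- The radical `𝔰(M)` as a submodule of `M` (the set `sSet R M` is closed under the
module operations, so it coincides with the submodule it generates). -/
def sSub (R : Type u) [Ring R] (M : Type u) [AddCommGroup M] [Module R M] :
    Submodule R M :=
  Submodule.span R (sSet R M)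

/-- A right-linear map given by a matrix acting on columns. -/
def colMap {R : Type u} [Ring R] {p q : ℕ} (D : Fin p → Fin q → R) :
    (Fin q → R) →ₗ[Rᵐᵒᵖ] (Fin p → R) where
  toFun w := fun i => ∑ j, D i j * w j
  map_add' x y := by
    funext i
    simp [mul_add, Finset.sum_add_distrib]
  map_smul' r x := by
    funext i
    simp [Finset.sum_mul, mul_assoc]

theorem projective_op_pi (R : Type u) [Ring R] (p : ℕ) :
    Module.Projective Rᵐᵒᵖ (Fin p → R) := by
  let e : (Fin p → Rᵐᵒᵖ) ≃ₗ[Rᵐᵒᵖ] (Fin p → R) :=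
    { toFun := fun w i => MulOpposite.unop (w i)
      invFun := fun w i => MulOpposite.op (w i)
      left_inv := fun _ => rfl
      right_inv := fun _ => rfl
      map_add' := fun _ _ => rfl
      map_smul' := fun _ _ => rfl }
  exact Module.Projective.of_equiv e

/-- The idempotent-like matrix splitting off the kernel of `D`. -/
theorem exists_split_matrix {R : Type u} [Ring R] (hsh : RightSemihereditary R) {p q : ℕ}
    (D : Fin p → Fin q → R) :
    ∃ C : Fin q → Fin q → R, (∀ i k, ∑ j, D i j * C j k = D i k) ∧
      ∀ w : Fin q → R, (∀ i, ∑ j, D i j * w j = 0) → ∀ i, ∑ j, C i j * w j = 0 := by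
  classical
  have hfin : Module.Finite Rᵐᵒᵖ R := by
    refine ⟨⟨{1}, ?_⟩⟩
    rw [eq_top_iff]
    intro x _
    have : x = MulOpposite.op x • (1 : R) := by simp
    rw [this]
    exact Submodule.smul_mem _ _ (Submodule.subset_span (by simp))
  have hP : Module.Projective Rᵐᵒᵖ (Fin p → R) := projective_op_pi R p
  have hN := hsh (Fin p → R) hP (LinearMap.range (colMap D))
    ((Module.Finite.iff_fg).1 (Module.Finite.range _))
  obtain ⟨σ, hσ⟩ := Module.projective_lifting_property (colMap D).rangeRestrict
    LinearMap.id (colMap D).surjective_rangeRestrict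
  have hσ' : ∀ w, colMap D (σ ((colMap D).rangeRestrict w)) = colMap D w := by
    intro w
    have := LinearMap.congr_fun hσ ((colMap D).rangeRestrict w)
    exact congrArg Subtype.val this
  let T := σ ∘ₗ (colMap D).rangeRestrict
  refine ⟨fun i j => T (Pi.single j 1) i, ?_, ?_⟩
  · intro i k
    have := congrFun (hσ' (Pi.single k 1)) i
    change ∑ j, D i j * T (Pi.single k 1) j = ∑ j, D i j * (Pi.single k 1 : Fin q → R) j at this
    rw [this]
    simp [Pi.single_apply]
  · intro w hw i
    have h0 : (colMap D).rangeRestrict w = 0 := by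
      apply Subtype.ext
      funext i
      exact hw i
    have hT : T w = 0 := by
      change σ _ = 0
      rw [h0, map_zero]
    have hwsum : w = ∑ j, MulOpposite.op (w j) • (Pi.single j 1 : Fin q → R) := by
      funext i
      simp [Finset.sum_apply, Pi.single_apply]
    have := congrFun hT i
    rw [hwsum, map_sum] at this
    simpa [Finset.sum_apply] using this

/-- Sufficient condition for membership in `sSet`. -/
theorem mem_sSet_of {R : Type u} [Ring R] {M : Type u} [AddCommGroup M] [Module R M]
    {ι κ : Type} [Fintype ι] [Fintype κ] (D : ι → κ → R) (c : κ → R)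
    (hlow : ∀ w : κ → R, (∀ i, ∑ j, D i j * w j = 0) → ∑ j, c j * w j = 0)
    (v : κ → M) (hv : ∀ i, ∑ j, D i j • v j = 0) : ∑ j, c j • v j ∈ sSet R M := by
  classical
  let e := Fintype.equivFin ι
  let f := Fintype.equivFin κ
  let φ : PPFormula R 1 :=
    { nExist := Fintype.card κ
      nEq := Fintype.card ι + 1
      coeffFree := Fin.cons (fun _ => -1) (fun _ _ => 0)
      coeffExist := Fin.cons (fun j => c (f.symm j)) (fun i j => D (e.symm i) (f.symm j)) }
  have key : ∀ (N : Type u) [AddCommGroup N] [Module R N] (m : N),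
      φ.Sat N (fun _ => m) ↔
        ∃ w : κ → N, (∀ i, ∑ j, D i j • w j = 0) ∧ ∑ j, c j • w j = m := by
    intro N _ _ m
    constructor
    · rintro ⟨y, hy⟩
      refine ⟨fun j => y (f j), ?_, ?_⟩
      · intro i
        have := hy (Fin.succ (e i))
        simp only [φ, Fin.cons_succ, zero_smul, Finset.sum_const_zero, zero_add,
          Equiv.symm_apply_apply] at this
        rw [← this]
        exact Fintype.sum_equiv f _ _ (fun j => by simp)
      · have := hy 0
        simp only [φ, Fin.cons_zero, Finset.univ_unique, Finset.sum_singleton, neg_smul,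
          one_smul, neg_add_eq_zero] at this
        rw [this]
        exact Fintype.sum_equiv f _ _ (fun j => by simp)
    · rintro ⟨w, hw, hm⟩
      refine ⟨fun j => w (f.symm j), ?_⟩
      intro i
      refine Fin.cases ?_ (fun i => ?_) i
      · simp only [φ, Fin.cons_zero, Finset.univ_unique, Finset.sum_singleton, neg_smul,
          one_smul, neg_add_eq_zero]
        rw [← hm]
        exact Fintype.sum_equiv f _ _ (fun j => by simp)
      · simp only [φ, Fin.cons_succ, zero_smul, Finset.sum_const_zero, zero_add]
        rw [← hw (e.symm i)]
        exact (Fintype.sum_equiv f _ _ (fun j => by simp)).symm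
  refine ⟨φ, ?_, (key M _).2 ⟨v, hv, rfl⟩⟩
  intro r hr
  obtain ⟨w, hw, rfl⟩ := (key R r).1 hr
  exact hlow w hw

/-- The matrix of a formula in one free variable. -/
def PPFormula.mat {R : Type u} [Ring R] (φ : PPFormula R 1) :
    Fin φ.nEq → Fin (φ.nExist + 1) → R :=
  fun i => Fin.cons (φ.coeffFree i 0) (φ.coeffExist i)

theorem PPFormula.sat_iff_mat {R : Type u} [Ring R] (φ : PPFormula R 1)
    (N : Type u) [AddCommGroup N] [Module R N] (m : N) :
    φ.Sat N (fun _ => m) ↔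
      ∃ v : Fin (φ.nExist + 1) → N, v 0 = m ∧ ∀ i, ∑ j, φ.mat i j • v j = 0 := by
  constructor
  · rintro ⟨y, hy⟩
    refine ⟨Fin.cons m y, rfl, fun i => ?_⟩
    have := hy i
    simpa [Fin.sum_univ_succ, PPFormula.mat] using this
  · rintro ⟨v, rfl, hv⟩
    refine ⟨fun j => v j.succ, fun i => ?_⟩
    have := hv i
    simpa [Fin.sum_univ_succ, PPFormula.mat] using this

theorem PPFormula.IsLow.mat {R : Type u} [Ring R] {φ : PPFormula R 1} (h : φ.IsLow)
    (w : Fin (φ.nExist + 1) → R) (hw : ∀ i, ∑ j, φ.mat i j * w j = 0) : w 0 = 0 :=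
  h _ ((φ.sat_iff_mat R _).2 ⟨w, rfl, hw⟩)

theorem sSet_smul {R : Type u} [Ring R] {M : Type u} [AddCommGroup M] [Module R M]
    (r : R) {m : M} (hm : m ∈ sSet R M) : r • m ∈ sSet R M := by
  classical
  obtain ⟨φ, hφ, hs⟩ := hm
  obtain ⟨v, rfl, hv⟩ := (φ.sat_iff_mat M m).1 hs
  have := mem_sSet_of φ.mat (Pi.single 0 r)
    (fun w hw => by simp [Pi.single_apply, hφ.mat w hw]) v hv
  simpa [Pi.single_apply, ite_smul] using this

theorem sSet_add {R : Type u} [Ring R] {M : Type u} [AddCommGroup M] [Module R M]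
    {m n : M} (hm : m ∈ sSet R M) (hn : n ∈ sSet R M) : m + n ∈ sSet R M := by
  classical
  obtain ⟨φ, hφ, hs⟩ := hm
  obtain ⟨v, rfl, hv⟩ := (φ.sat_iff_mat M m).1 hs
  obtain ⟨ψ, hψ, ht⟩ := hn
  obtain ⟨u, rfl, hu⟩ := (ψ.sat_iff_mat M n).1 ht
  have := mem_sSet_of
    (Sum.elim (fun i => Sum.elim (φ.mat i) 0) (fun i => Sum.elim 0 (ψ.mat i)))
    (Sum.elim (Pi.single 0 1) (Pi.single 0 1))
    (fun w hw => by
      have h1 := hφ.mat (fun j => w (Sum.inl j)) (fun i => by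
        have := hw (Sum.inl i)
        simpa using this)
      have h2 := hψ.mat (fun j => w (Sum.inr j)) (fun i => by
        have := hw (Sum.inr i)
        simpa using this)
      simp [Pi.single_apply, h1, h2])
    (Sum.elim v u)
    (by
      rintro (i | i)
      · simpa using hv i
      · simpa using hu i)
  simpa [Pi.single_apply, ite_smul] using this

theorem sSet_zero (R : Type u) [Ring R] (M : Type u) [AddCommGroup M] [Module R M] :
    (0 : M) ∈ sSet R M := by
  have := mem_sSet_of (R := R) (M := M) (ι := Empty) (κ := Empty) (fun _ _ => 0) (fun _ => 0)
    (fun w hw => by simp) (fun _ => 0) (fun i => by simp)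
  simpa using this

theorem coe_sSub (R : Type u) [Ring R] (M : Type u) [AddCommGroup M] [Module R M] :
    (sSub R M : Set M) = sSet R M := by
  apply Set.Subset.antisymm _ Submodule.subset_span
  intro x hx
  induction hx using Submodule.span_induction with
  | mem x h => exact h
  | zero => exact sSet_zero R M
  | add x y _ _ h1 h2 => exact sSet_add h1 h2
  | smul r x _ h => exact sSet_smul r h

theorem sSub_isSTorsion (R : Type u) [Ring R] (hsh : RightSemihereditary R)
    (M : Type u) [AddCommGroup M] [Module R M] : IsSTorsion R ↥(sSub R M) := by
  classical
  rintro ⟨m, hm⟩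
  have hm' : m ∈ sSet R M := by
    rw [← coe_sSub]
    exact hm
  obtain ⟨φ, hφ, hs⟩ := hm'
  refine ⟨φ, hφ, ?_⟩
  obtain ⟨v, rfl, hv⟩ := (φ.sat_iff_mat M m).1 hs
  obtain ⟨C, hDC, hC⟩ := exists_split_matrix hsh φ.mat
  have hz : ∀ i, ∑ j, C i j • v j ∈ sSub R M := fun i =>
    Submodule.subset_span (mem_sSet_of φ.mat (C i) (fun w hw => hC w hw i) v hv)
  -- the first row of `C` is that of the identity matrix
  have hrow : ∀ k, C 0 k = (Pi.single k 1 : Fin (φ.nExist + 1) → R) 0 := by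
    intro k
    have := hφ.mat (fun j => C j k - (Pi.single k 1 : Fin (φ.nExist + 1) → R) j) (fun i => by
      simp [mul_sub, Finset.sum_sub_distrib, hDC, Pi.single_apply])
    exact sub_eq_zero.1 this
  refine (φ.sat_iff_mat _ _).2 ⟨fun i => ⟨∑ j, C i j • v j, hz i⟩, ?_, ?_⟩
  · apply Subtype.ext
    simp [hrow, Pi.single_apply, ite_smul]
  · intro i
    apply Subtype.ext
    simp only [Submodule.coe_sum, Submodule.coe_smul, Submodule.coe_zero, Finset.smul_sum,
      smul_smul]
    rw [Finset.sum_comm]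
    simp only [← Finset.sum_smul, hDC]
    exact hv i

/-- **Proposition.** Assume `R` is right semihereditary.  Then for every left
`R`-module `M`: the radical `𝔰(M)` is exactly the set of elements satisfying a low
pp-formula, `𝔰` is idempotent, i.e. `𝔰(𝔰(M)) = 𝔰(M)`, and `𝔰(M)` is an `𝔰`-torsion
module. -/
theorem sRadical_idempotent (R : Type u) [Ring R] (hsh : RightSemihereditary R)
    (M : Type u) [AddCommGroup M] [Module R M] :
    ((sSub R M : Set M) = sSet R M) ∧
      sSub R ↥(sSub R M) = ⊤ ∧ IsSTorsion R ↥(sSub R M) := by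
  refine ⟨coe_sSub R M, ?_, sSub_isSTorsion R hsh M⟩
  rw [eq_top_iff]
  intro x _
  exact Submodule.subset_span (sSub_isSTorsion R hsh M x)
end
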